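/- For every permutation σ of {1, …, n}, the sum of the diagonal entries Σ_{i=1}^n (L_σ)_{ii} equals h(w^σ_1) − 1 + #{i : σ(i) = i}, where h(v) denotes the number of coordinates of the vector v equal to 1. -/

import Mathlib

/-- `eVec n m` is the standard basis column vector `e_m` of `ℤ^n` (1-based index `m`,
with `e_{n+1} = 0`; indeed `eVec n m = 0` whenever `m = 0` or `m > n`). -/
def eVec (n : ℕ) (m : ℕ) : Fin n → ℤ := fun i => if (i : ℕ) + 1 = m then 1 else 0

/-- `deltaVec n m` is `δ_m = e_{m+1} - e_m` (1-based index `m`). -/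
def deltaVec (n : ℕ) (m : ℕ) : Fin n → ℤ := eVec n (m + 1) - eVec n m

/-- `Dset σ` is the set `D(σ) = {1} ∪ {k : σ⁻¹(k−1) > σ⁻¹(k)}` of the paper, encoded
0-based: the element `i : Fin n` represents `k = i + 1` of `{1, …, n}`. -/
def Dset {n : ℕ} (σ : Equiv.Perm (Fin n)) : Finset (Fin n) :=
  Finset.univ.filter fun i => (i : ℕ) = 0 ∨ σ⁻¹ i < σ⁻¹ ⟨(i : ℕ) - 1, lt_of_le_of_lt (Nat.sub_le _ _) i.isLt⟩

/-- `wVec σ j` is the vector `w^σ_{j+1}` of the paper (so `wVec σ 0 = w^σ_1` is the sum of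
the `e_i` over `i ∈ D(σ)`, and `wVec σ j = wVec σ (j-1) + δ_{σ(j)}` for `1 ≤ j ≤ n`,
where the permutation of `{1, …, n}` is encoded 0-based as `σ : Equiv.Perm (Fin n)`). -/
def wVec {n : ℕ} (σ : Equiv.Perm (Fin n)) : ℕ → (Fin n → ℤ)
  | 0 => ∑ i ∈ Dset σ, eVec n ((i : ℕ) + 1)
  | j + 1 => wVec σ j + (if h : j < n then deltaVec n ((σ ⟨j, h⟩ : ℕ) + 1) else 0)

/-- `Lmat σ` is the `n × (n+1)` matrix `L_σ` whose columns are `w^σ_1, …, w^σ_{n+1}`. -/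
def Lmat {n : ℕ} (σ : Equiv.Perm (Fin n)) : Matrix (Fin n) (Fin (n + 1)) ℤ :=
  Matrix.of fun i j => wVec σ (j : ℕ) i

/-- `Mmat σ` is the `n × n` matrix `M_σ` whose `j`-th column is `w^σ_j - w^σ_{n+1}`. -/
def Mmat {n : ℕ} (σ : Equiv.Perm (Fin n)) : Matrix (Fin n) (Fin n) ℤ :=
  Matrix.of fun i j => wVec σ (j : ℕ) i - wVec σ n i

/-- `Pmat σ` is the permutation matrix `P_σ = (p_{ij})`, `p_{ij} = ⟦j = σ(i)⟧`. -/
def Pmat {n : ℕ} (R : Type*) [Zero R] [One R] (σ : Equiv.Perm (Fin n)) :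
    Matrix (Fin n) (Fin n) R :=
  Matrix.of fun i j => if j = σ i then 1 else 0

theorem wVec_zero_apply {n : ℕ} (σ : Equiv.Perm (Fin n)) (i : Fin n) :
    wVec σ 0 i = if i ∈ Dset σ then 1 else 0 := by
  simp [wVec, Finset.sum_apply, eVec, Fin.val_inj]

/-- The `i`-th coordinate of `wVec σ j` is determined by membership in `Dset σ` and by which of
`i - 1` and `i` are among the first `j` values of `σ`. -/
theorem wVec_apply {n : ℕ} (σ : Equiv.Perm (Fin n)) (j : ℕ) (i : Fin n) :
    wVec σ j i = (if i ∈ Dset σ then 1 else 0) +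
      (if (i : ℕ) ≠ 0 ∧
        (σ⁻¹ ⟨(i : ℕ) - 1, lt_of_le_of_lt (Nat.sub_le _ _) i.isLt⟩ : ℕ) < j then 1 else 0) -
      (if (σ⁻¹ i : ℕ) < j then 1 else 0) := by
  induction j with
  | zero => simp [wVec_zero_apply]
  | succ j ih =>
    rw [wVec, Pi.add_apply, ih]
    have hpos : ∀ (k : Fin n) (h : j < n), (k : ℕ) = σ ⟨j, h⟩ ↔ (σ⁻¹ k : ℕ) = j := by
      intro k h
      rw [Fin.val_inj, ← Equiv.Perm.inv_eq_iff_eq, Fin.ext_iff]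
    have hi := (σ⁻¹ i).isLt
    have hp := (σ⁻¹ ⟨(i : ℕ) - 1, lt_of_le_of_lt (Nat.sub_le _ _) i.isLt⟩).isLt
    by_cases h : j < n
    · have hpos_i := hpos i h
      have hpos_pred := hpos ⟨(i : ℕ) - 1, lt_of_le_of_lt (Nat.sub_le _ _) i.isLt⟩ h
      simp only [h, dite_true, deltaVec, eVec, Pi.sub_apply]
      grind
    · simp only [h, dite_false, Pi.zero_apply]
      grind

/-- The sum of the diagonal entries of `L_σ` equals `h(w^σ_1) - 1 + #{i : σ(i) = i}`,
where `h(v)` is the number of coordinates of `v` equal to `1`. -/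
theorem Lmat_diagonal_sum (n : ℕ) (hn : 0 < n) (σ : Equiv.Perm (Fin n)) :
    ∑ i : Fin n, Lmat σ i (Fin.castSucc i) =
      ((Finset.univ.filter fun x => wVec σ 0 x = 1).card : ℤ) - 1 +
        ((Finset.univ.filter fun i => σ i = i).card : ℤ) := by
  obtain ⟨m, rfl⟩ : ∃ m, n = m + 1 := ⟨n - 1, by omega⟩
  have hcard : ((Finset.univ.filter fun x => wVec σ 0 x = 1).card : ℤ) =
      ∑ i : Fin (m + 1), if i ∈ Dset σ then (1 : ℤ) else 0 := by
    simp [wVec_zero_apply]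
  have hfix : ((Finset.univ.filter fun i => σ i = i).card : ℤ) =
      ∑ i : Fin (m + 1), if σ⁻¹ i = i then (1 : ℤ) else 0 := by
    rw [Finset.card_filter, Nat.cast_sum]
    refine Finset.sum_congr rfl fun i _ => ?_
    simp only [Equiv.Perm.inv_eq_iff_eq, eq_comm (a := i), Nat.cast_ite,
      Nat.cast_one, Nat.cast_zero]
  have hweak : (∑ i : Fin (m + 1), if σ⁻¹ i ≤ i then (1 : ℤ) else 0) =
      (∑ i : Fin (m + 1), if σ⁻¹ i < i then (1 : ℤ) else 0) +
        ∑ i : Fin (m + 1), if σ⁻¹ i = i then (1 : ℤ) else 0 := by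
    rw [← Finset.sum_add_distrib]
    refine Finset.sum_congr rfl fun i _ => ?_
    grind
  have hshift : (∑ i : Fin (m + 1), if σ⁻¹ i ≤ i then (1 : ℤ) else 0) =
      (∑ i : Fin (m + 1), if (i : ℕ) ≠ 0 ∧
        (σ⁻¹ ⟨(i : ℕ) - 1, lt_of_le_of_lt (Nat.sub_le _ _) i.isLt⟩ : ℕ) < i
        then (1 : ℤ) else 0) + 1 := by
    rw [Fin.sum_univ_castSucc, Fin.sum_univ_succ]
    simp [Fin.le_def, Fin.castSucc, Fin.castAdd, Fin.castLE, Fin.is_le]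
  rw [hcard, hfix]
  simp only [Lmat, Matrix.of_apply, wVec_apply, Fin.val_castSucc, Finset.sum_add_distrib,
    Finset.sum_sub_distrib]
  simp only [Fin.lt_def] at hweak
  linarith
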